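/- Let X be an S-scheme locally of finite type, W ⊆ X an irreducible closed subset, Y a locally Noetherian S-scheme locally of finite type, and f : X → Y an S-morphism such that the restriction f|_W : W → Y is proper and dim_S(W) = dim_S(f(W)). Assume the base S is excellent. Then there exists an open U ⊆ Y such that: U ∩ f(W) is nonempty and regular, f^{-1}(U) ∩ W is regular, and the restricted map f' : f^{-1}(U) ∩ W → U ∩ f(W) is finite. -/

import Mathlib

/-!
STATEMENT 4: Let `X` be an `S`-scheme locally of finite type, `W ⊆ X` an irreducible
closed subset, `Y` a locally Noetherian `S`-scheme locally of finite type, and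
`f : X → Y` an `S`-morphism such that `f|_W : W → Y` is proper and
`dim_S W = dim_S f(W)`.  Assume `S` is excellent (we use the J-2 consequence: regular
loci of finite-type `S`-schemes are open).  Then there is an open `U ⊆ Y` such that
`U ∩ f(W)` is nonempty and regular, `f⁻¹(U) ∩ W` is regular, and the restricted map
`f' : f⁻¹(U) ∩ W → U ∩ f(W)` is finite.

We represent `W` (resp. `f(W)`) with its reduced induced scheme structure by a reduced
scheme `WS` (resp. `FW`) with a closed immersion onto `W` (resp. onto the image of `W`),
and regularity of `U ∩ f(W)` (resp. `f⁻¹(U) ∩ W`) means the stalks of `FW` (resp. `WS`)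
at all points lying over `U` are regular local rings.  The relative dimension `dim_S` of
an integral closed subscheme with generic point `x` is recorded (shifted by `+1`) by
`SDimSucc`, via the dimension formula.
-/

open AlgebraicGeometry CategoryTheory TopologicalSpace

universe u

/-- A regular local ring (predicate version). -/
def IsRegularLocalRingP (R : Type*) [CommRing R] : Prop :=
  IsNoetherianRing R ∧ ∃ s : Finset R,
    Ideal.span (s : Set R) ≠ ⊤ ∧ (∀ I : Ideal R, I ≠ ⊤ → I ≤ Ideal.span (s : Set R)) ∧
    (s.card : WithBot (WithTop ℕ)) = ringKrullDim R

open Classical in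
/-- `1 + dim_S (closure {x})` for the integral closed subscheme with generic point `x`:
the Krull dimension of the generic fibre plus `1` if it dominates `S`, plus `0`
otherwise. -/
noncomputable def SDimSucc {X S : Scheme.{u}} [IrreducibleSpace S] (p : X ⟶ S) (x : X) :
    WithBot ℕ∞ :=
  topologicalKrullDim {y : X | y ∈ closure {x} ∧ p.base y = p.base x} +
    (if p.base x = genericPoint S then 1 else 0)

theorem ringKrullDim_eq_of_isIntegral_of_injective (R S : Type*) [CommRing R] [CommRing S]
    [Algebra R S] [Algebra.IsIntegral R S]
    (h : Function.Injective (algebraMap R S)) : ringKrullDim R = ringKrullDim S := by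
  apply le_antisymm
  · refine iSup_le fun l ↦ ?_
    obtain ⟨P, hP, hPl⟩ := Ideal.exists_ideal_over_prime_of_isIntegral (S := S) l.head.asIdeal ⊥
      (by rw [← RingHom.ker_eq_comap_bot, (RingHom.injective_iff_ker_eq_bot _).mp h]; exact bot_le)
    have : P.LiesOver l.head.asIdeal := ⟨hPl.2.symm⟩
    have := hPl.1
    obtain ⟨L, hL, -⟩ := Ideal.exists_ltSeries_of_hasGoingUp l P
    rw [← hL]
    exact Order.LTSeries.length_le_krullDim L
  · exact Order.krullDim_le_of_strictMono (PrimeSpectrum.comap (algebraMap R S))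
      fun I J hIJ ↦ Ideal.IsIntegral.comap_lt_comap (R := R) hIJ

theorem exists_ringKrullDim_eq_and_trdeg_eq (k A : Type u) [Field k] [CommRing A] [IsDomain A]
    [Algebra k A] [Algebra.FiniteType k A] :
    ∃ n : ℕ, ringKrullDim A = n ∧ Algebra.trdeg k A = n := by
  obtain ⟨n, g, hg, hfin⟩ := exists_integral_inj_algHom_of_fg k A
  algebraize [g.toRingHom]
  have : IsScalarTower k (MvPolynomial (Fin n) k) A := .of_algebraMap_eq' g.comp_algebraMap.symm
  have : Algebra.IsIntegral (MvPolynomial (Fin n) k) A := ⟨hfin⟩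
  have : FaithfulSMul (MvPolynomial (Fin n) k) A :=
    (faithfulSMul_iff_algebraMap_injective _ _).mpr hg
  refine ⟨n, ?_, ?_⟩
  · rw [← ringKrullDim_eq_of_isIntegral_of_injective (MvPolynomial (Fin n) k) A hg]
    simp [MvPolynomial.ringKrullDim_of_isNoetherianRing]
  · rw [← trdeg_add_eq k (MvPolynomial (Fin n) k) (A := A)]
    simp [MvPolynomial.trdeg_of_isDomain, trdeg_eq_zero]

theorem trdeg_eq_trdeg_of_isFractionRing (k A K : Type u) [Field k] [CommRing A] [IsDomain A]
    [Field K] [Algebra k A] [Algebra A K] [Algebra k K] [IsScalarTower k A K]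
    [IsFractionRing A K] : Algebra.trdeg k A = Algebra.trdeg k K := by
  have : Algebra.IsAlgebraic A K := IsLocalization.isAlgebraic K (nonZeroDivisors A)
  rw [← trdeg_add_eq k A (A := K), trdeg_eq_zero (R := A), add_zero]

/-- The transcendence degree of a ring homomorphism. -/
noncomputable def RingHom.trdeg {R S : Type*} [CommRing R] [CommRing S] (φ : R →+* S) : Cardinal :=
  letI := φ.toAlgebra
  Algebra.trdeg R S

theorem RingHom.trdeg_le {R S T : Type u} [CommRing R] [CommRing S] [CommRing T] (φ : R →+* S)
    (ψ : S →+* T) (h : Function.Injective ψ) : φ.trdeg ≤ (ψ.comp φ).trdeg := by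
  algebraize [φ, ψ, ψ.comp φ]
  exact trdeg_le_of_injective (IsScalarTower.toAlgHom R S T) h

namespace AlgebraicGeometry

variable {k : Type u} [Field k]

/-- The homomorphism from the base field to the residue field of a point. -/
noncomputable def Scheme.Hom.toResidueField {Z : Scheme.{u}} (p : Z ⟶ Spec (.of k)) (z : Z) :
    k →+* Z.residueField z :=
  (Spec.preimage (Z.fromSpecResidueField z ≫ p)).hom

theorem Scheme.Hom.toResidueField_comp {X Y : Scheme.{u}} (f : X ⟶ Y) (p : Y ⟶ Spec (.of k))
    (x : X) :
    (f ≫ p).toResidueField x = (f.residueFieldMap x).hom.comp (p.toResidueField (f x)) := by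
  rw [toResidueField, toResidueField, ← CommRingCat.hom_comp]
  congr 1
  apply Spec.map_injective
  simp

theorem Scheme.Hom.trdeg_toResidueField_le {X Y : Scheme.{u}} (f : X ⟶ Y) (p : Y ⟶ Spec (.of k))
    (x : X) : (p.toResidueField (f x)).trdeg ≤ ((f ≫ p).toResidueField x).trdeg := by
  rw [toResidueField_comp]
  exact RingHom.trdeg_le _ _ (RingHom.injective _)

theorem Scheme.Hom.trdeg_toResidueField_eq {X Y : Scheme.{u}} (f : X ⟶ Y) [IsOpenImmersion f]
    (p : Y ⟶ Spec (.of k))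
    (x : X) : ((f ≫ p).toResidueField x).trdeg = (p.toResidueField (f x)).trdeg := by
  refine (f.trdeg_toResidueField_le p x).antisymm' ?_
  rw [toResidueField_comp]
  refine (RingHom.trdeg_le _ (inv (f.residueFieldMap x)).hom (RingHom.injective _)).trans_eq ?_
  rw [← RingHom.comp_assoc, ← CommRingCat.hom_comp]
  simp

theorem _root_.Topology.IsEmbedding.topologicalKrullDim_eq {X Y : Type*} [TopologicalSpace X]
    [TopologicalSpace Y] {f : X → Y} (hf : Topology.IsEmbedding f) :
    topologicalKrullDim X = topologicalKrullDim (Set.range f) :=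
  hf.toHomeomorph.isHomeomorph.topologicalKrullDim_eq

theorem _root_.PrimeSpectrum.topologicalKrullDim_closure_singleton {A : Type*} [CommRing A]
    (q : PrimeSpectrum A) :
    topologicalKrullDim (closure {q} : Set (PrimeSpectrum A)) = ringKrullDim (A ⧸ q.asIdeal) := by
  have h := PrimeSpectrum.isClosedEmbedding_comap_of_surjective (A ⧸ q.asIdeal)
    (Ideal.Quotient.mk q.asIdeal) Ideal.Quotient.mk_surjective
  rw [← PrimeSpectrum.topologicalKrullDim_eq_ringKrullDim, h.isEmbedding.topologicalKrullDim_eq,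
    _root_.range_comap_of_surjective _ _ Ideal.Quotient.mk_surjective, Ideal.mk_ker,
    PrimeSpectrum.closure_singleton]

theorem exists_topologicalKrullDim_eq_and_trdeg_eq_of_Spec {A : CommRingCat.{u}}
    (p : Spec A ⟶ Spec (.of k)) [LocallyOfFiniteType p] (q : Spec A) :
    ∃ n : ℕ, topologicalKrullDim (closure {q} : Set (Spec A)) = n ∧
      (p.toResidueField q).trdeg = n := by
  obtain ⟨φ, rfl⟩ := Spec.map_surjective p
  have hφ := (HasRingHomProperty.Spec_iff (P := @LocallyOfFiniteType)).mp ‹_›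
  have : q.asIdeal.IsPrime := PrimeSpectrum.isPrime q
  algebraize [φ.hom]
  have : Algebra.FiniteType k A := hφ
  have : Algebra.FiniteType k (A ⧸ q.asIdeal) := .trans this inferInstance
  obtain ⟨n, hn, hn'⟩ := exists_ringKrullDim_eq_and_trdeg_eq k (A ⧸ q.asIdeal)
  refine ⟨n, (PrimeSpectrum.topologicalKrullDim_closure_singleton q).trans hn, ?_⟩
  rw [← hn', trdeg_eq_trdeg_of_isFractionRing k _ q.asIdeal.ResidueField]
  have h : (Spec.map φ).toResidueField q = (Scheme.Spec.residueFieldIso A q).inv.hom.comp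
      (algebraMap k q.asIdeal.ResidueField) := by
    rw [Scheme.Hom.toResidueField,
      ← Scheme.Spec.map_residueFieldIso_inv_eq_fromSpecResidueField, Category.assoc,
      ← Spec.map_comp, ← Spec.map_comp, Spec.preimage_map, CommRingCat.hom_comp,
      CommRingCat.hom_comp]
    rfl
  have h' : algebraMap k q.asIdeal.ResidueField = (Scheme.Spec.residueFieldIso A q).hom.hom.comp
      ((Spec.map φ).toResidueField q) := by
    rw [h, ← RingHom.comp_assoc, ← CommRingCat.hom_comp]
    simp
  change _ = (algebraMap k q.asIdeal.ResidueField).trdeg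
  apply le_antisymm
  · rw [h']
    exact RingHom.trdeg_le _ _ (RingHom.injective _)
  · rw [h]
    exact RingHom.trdeg_le _ _ (RingHom.injective _)

theorem _root_.Topology.IsInducing.closure_singleton_eq_preimage {X Y : Type*} [TopologicalSpace X]
    [TopologicalSpace Y] {f : X → Y} (hf : Topology.IsInducing f) (x : X) :
    closure {x} = f ⁻¹' closure {f x} := by
  rw [hf.closure_eq_preimage_closure_image, Set.image_singleton]

theorem _root_.Topology.IsInducing.topologicalKrullDim_closure_singleton_le {X Y : Type*}
    [TopologicalSpace X] [TopologicalSpace Y] {f : X → Y} (hf : Topology.IsInducing f) (x : X) :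
    topologicalKrullDim (closure {x} : Set X) ≤ topologicalKrullDim (closure {f x} : Set Y) := by
  rw [hf.closure_singleton_eq_preimage x]
  exact (hf.restrictPreimage _).topologicalKrullDim_le

theorem _root_.TopologicalSpace.IrreducibleCloseds.coheight_le_topologicalKrullDim {X Y : Type*}
    [TopologicalSpace X] [TopologicalSpace Y] {f : X → Y} (hf : Topology.IsOpenEmbedding f)
    (Z : IrreducibleCloseds Y) (hZ : (f ⁻¹' Z).Nonempty) :
    (Order.coheight Z : WithBot ℕ∞) ≤ topologicalKrullDim X := by
  have h := (IrreducibleCloseds.orderIsoOfIsOpenEmbedding f hf).apply_symm_apply ⟨Z, hZ⟩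
  have h' := hf.coheight_map ((IrreducibleCloseds.orderIsoOfIsOpenEmbedding f hf).symm ⟨Z, hZ⟩)
  have h'' : IrreducibleCloseds.map f hf.continuous
    ((IrreducibleCloseds.orderIsoOfIsOpenEmbedding f hf).symm ⟨Z, hZ⟩) = Z := congr_arg Subtype.val h
  rw [← h'', h']
  exact Order.coheight_le_krullDim _

theorem exists_topologicalKrullDim_eq_and_trdeg_eq {Z : Scheme.{u}}
    (p : Z ⟶ Spec (.of k)) [LocallyOfFiniteType p] (z : Z) :
    ∃ n : ℕ, topologicalKrullDim (closure {z} : Set Z) = n ∧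
      (p.toResidueField z).trdeg = n := by
  have key (c : Z) (hc : c ∈ closure {z}) : ∃ (A : CommRingCat.{u}) (j : Spec A ⟶ Z) (q : Spec A),
      IsOpenImmersion j ∧ c ∈ Set.range j ∧ j q = z := by
    obtain ⟨b, hb⟩ := Z.affineCover.covers c
    obtain ⟨q, hq⟩ := (specializes_iff_mem_closure.mpr hc).mem_open
      (Z.affineCover.f (Z.affineCover.idx c)).isOpenEmbedding.isOpen_range ⟨b, hb⟩
    exact ⟨_, Z.affineCover.f (Z.affineCover.idx c), q,
      inferInstanceAs (IsOpenImmersion (Z.affineCover.f _)), ⟨b, hb⟩, hq⟩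
  obtain ⟨A, j, q, hj, -, rfl⟩ := key z (subset_closure rfl)
  obtain ⟨n, hn, hn'⟩ := exists_topologicalKrullDim_eq_and_trdeg_eq_of_Spec (j ≫ p) q
  rw [j.trdeg_toResidueField_eq] at hn'
  refine ⟨n, le_antisymm ?_ ?_, hn'⟩
  · rw [topologicalKrullDim, Order.krullDim_eq_iSup_coheight]
    refine iSup_le fun C ↦ ?_
    obtain ⟨c, hc⟩ := C.isIrreducible.nonempty
    obtain ⟨A', j', q', hj', ⟨b, hb⟩, hq'⟩ := key c c.2
    obtain ⟨m, hm, hm'⟩ := exists_topologicalKrullDim_eq_and_trdeg_eq_of_Spec (j' ≫ p) q'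
    rw [j'.trdeg_toResidueField_eq, hq', hn'] at hm'
    obtain rfl : n = m := by exact_mod_cast hm'
    rw [← hm, j'.isOpenEmbedding.isInducing.closure_singleton_eq_preimage q', hq']
    exact C.coheight_le_topologicalKrullDim (j'.isOpenEmbedding.restrictPreimage _)
      ⟨⟨b, by simp [hb]⟩, by simpa [hb]⟩
  · rw [← hn]
    exact j.isOpenEmbedding.isInducing.topologicalKrullDim_closure_singleton_le q

theorem _root_.topologicalKrullDim_closure_singleton_add_one_le {X : Type*} [TopologicalSpace X]
    [T0Space X] {x y : X} (h : x ⤳ y) (hne : x ≠ y) :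
    topologicalKrullDim (closure {y} : Set X) + 1 ≤ topologicalKrullDim (closure {x} : Set X) := by
  have hyx : closure {y} ⊆ closure {x} := specializes_iff_closure_subset.mp h
  have hemb : Topology.IsEmbedding (Set.inclusion hyx) := .inclusion hyx
  have : IrreducibleSpace (closure {x} : Set X) :=
    isIrreducible_iff_irreducibleSpace.mp isIrreducible_singleton.closure
  have : IrreducibleSpace (closure {y} : Set X) :=
    isIrreducible_iff_irreducibleSpace.mp isIrreducible_singleton.closure
  have : Nonempty (IrreducibleCloseds (closure {y} : Set X)) :=
    ⟨⟨Set.univ, IrreducibleSpace.isIrreducible_univ _, isClosed_univ⟩⟩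
  let T : IrreducibleCloseds (closure {x} : Set X) :=
    ⟨Set.univ, IrreducibleSpace.isIrreducible_univ _, isClosed_univ⟩
  rw [topologicalKrullDim, ← Order.krullDim_WithTop]
  refine Order.krullDim_le_of_strictMono
    (WithTop.recTopCoe T (IrreducibleCloseds.map _ hemb.continuous)) ?_
  refine WithTop.strictMono_iff.mpr
    ⟨IrreducibleCloseds.map_strictMono_of_isInducing hemb.isInducing, fun C ↦ ?_⟩
  refine lt_of_le_not_ge (Set.subset_univ _) fun hC ↦ hne (h.antisymm ?_).eq
  have hx : (⟨x, subset_closure rfl⟩ : closure {x}) ∈ closure (Set.inclusion hyx '' C) :=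
    hC (Set.mem_univ _)
  have hcl : IsClosed {z : closure {x} | (z : X) ∈ closure {y}} :=
    isClosed_closure.preimage continuous_subtype_val
  exact specializes_iff_mem_closure.mpr
    (closure_minimal (Set.image_subset_iff.mpr fun c _ ↦ c.2) hcl hx)

theorem topologicalKrullDim_closure_singleton_lt {X Y : Scheme.{u}} (f : X ⟶ Y)
    (p : Y ⟶ Spec (.of k)) [LocallyOfFiniteType p] [LocallyOfFiniteType (f ≫ p)] {x x' : X}
    (h : x ⤳ x') (hne : x ≠ x') (hf : f x = f x') :
    topologicalKrullDim (closure {f x} : Set Y) < topologicalKrullDim (closure {x} : Set X) := by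
  obtain ⟨n, hn, hn'⟩ := exists_topologicalKrullDim_eq_and_trdeg_eq p (f x)
  obtain ⟨m, hm, hm'⟩ := exists_topologicalKrullDim_eq_and_trdeg_eq (f ≫ p) x'
  have hle := f.trdeg_toResidueField_le p x'
  rw [← hf, hn', hm'] at hle
  have hle' : n ≤ m := by exact_mod_cast hle
  have := topologicalKrullDim_closure_singleton_add_one_le h hne
  rw [hm] at this
  rw [hn]
  refine lt_of_lt_of_le ?_ this
  exact_mod_cast Nat.lt_succ_of_le hle'

instance {X S : Scheme.{u}} (p : X ⟶ S) [LocallyOfFiniteType p] (s : S) :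
    LocallyOfFiniteType (p.fiberToSpecResidueField s) :=
  inferInstanceAs (LocallyOfFiniteType (Limits.pullback.snd _ _))

theorem Scheme.Hom.topologicalKrullDim_closure_singleton_fiber {X S : Scheme.{u}} (p : X ⟶ S)
    (s : S) (x : p.fiber s) :
    topologicalKrullDim (closure {x} : Set (p.fiber s)) =
      topologicalKrullDim {y : X | y ∈ closure {p.fiberι s x} ∧ p y = s} := by
  have h : Set.range (p.fiberι s ∘ ((↑) : closure {x} → p.fiber s)) =
      {y : X | y ∈ closure {p.fiberι s x} ∧ p y = s} := by
    rw [Set.range_comp, Subtype.range_val,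
      (p.fiberι s).isEmbedding.isInducing.closure_singleton_eq_preimage,
      Set.image_preimage_eq_inter_range, p.range_fiberι]
    rfl
  rw [((p.fiberι s).isEmbedding.comp .subtypeVal).topologicalKrullDim_eq, h]

theorem topologicalKrullDim_fiber_closure_singleton_lt {X Y S : Scheme.{u}} (f : X ⟶ Y)
    (p : Y ⟶ S) [LocallyOfFiniteType p] [LocallyOfFiniteType (f ≫ p)] {x x' : X}
    (h : x ⤳ x') (hne : x ≠ x') (hf : f x = f x') :
    topologicalKrullDim {y : Y | y ∈ closure {f x} ∧ p y = p (f x)} <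
      topologicalKrullDim {y : X | y ∈ closure {x} ∧ (f ≫ p) y = (f ≫ p) x} := by
  have hs : (f ≫ p) x' = (f ≫ p) x := by simp [hf]
  let s := (f ≫ p) x
  let ι := (f ≫ p).fiberι s
  obtain ⟨ξ, hξ⟩ : ∃ ξ, ι ξ = x := by
    rw [← Set.mem_range, (f ≫ p).range_fiberι]; rfl
  obtain ⟨ξ', hξ'⟩ : ∃ ξ', ι ξ' = x' := by
    rw [← Set.mem_range, (f ≫ p).range_fiberι]; exact hs
  let g : (f ≫ p).fiber s ⟶ p.fiber s := Limits.pullback.lift (ι ≫ f)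
    ((f ≫ p).fiberToSpecResidueField s) (by simpa using (f ≫ p).fiber_fac s)
  have hg : g ≫ p.fiberι s = ι ≫ f := Limits.pullback.lift_fst ..
  have hg' : g ≫ p.fiberToSpecResidueField s = (f ≫ p).fiberToSpecResidueField s :=
    Limits.pullback.lift_snd ..
  have hgι (a) : p.fiberι s (g a) = f (ι a) := by
    rw [← Scheme.Hom.comp_apply, hg, Scheme.Hom.comp_apply]
  have : LocallyOfFiniteType (g ≫ p.fiberToSpecResidueField s) := hg' ▸ inferInstance
  have key := topologicalKrullDim_closure_singleton_lt (k := S.residueField s) g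
    (p.fiberToSpecResidueField s) (x := ξ) (x' := ξ')
    (ι.isEmbedding.isInducing.specializes_iff.mp (by rwa [hξ, hξ']))
    (fun e ↦ hne (by rw [← hξ, ← hξ', e]))
    ((p.fiberι s).isEmbedding.injective (by rw [hgι, hgι, hξ, hξ', hf]))
  rw [Scheme.Hom.topologicalKrullDim_closure_singleton_fiber,
    Scheme.Hom.topologicalKrullDim_closure_singleton_fiber, hgι] at key
  change _ < topologicalKrullDim {y : X | y ∈ closure {ι ξ} ∧ (f ≫ p) y = s} at key
  rwa [hξ] at key

theorem isField_stalk_of_closure_eq_univ {X : Scheme.{u}} [IsReduced X] {x : X}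
    (h : closure {x} = Set.univ) : IsField (X.presheaf.stalk x) := by
  have : IrreducibleSpace X := by
    rw [irreducibleSpace_def, Set.top_eq_univ, ← h]
    exact isIrreducible_singleton.closure
  have : IsIntegral X := isIntegral_of_irreducibleSpace_of_isReduced X
  obtain rfl : x = genericPoint X :=
    IsGenericPoint.eq (S := Set.univ) h (genericPoint_spec X)
  exact Field.toIsField X.functionField

theorem isFinite_morphismRestrict_of_preimage_le_quasiFiniteLocus {X Y : Scheme.{u}} (f : X ⟶ Y)
    [IsProper f] (V : Y.Opens) (h : f ⁻¹ᵁ V ≤ f.quasiFiniteLocus) : IsFinite (f ∣_ V) := by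
  have : LocallyQuasiFinite (f ∣_ V) := by
    refine (f ∣_ V).quasiFiniteLocus_eq_top_iff.mp (top_le_iff.mp fun x _ ↦ ?_)
    rw [Scheme.Hom.mem_quasiFiniteLocus, ← Scheme.Hom.quasiFiniteAt_comp_iff (g := V.ι),
      morphismRestrict_ι, Scheme.Hom.quasiFiniteAt_comp_iff_of_isOpenImmersion]
    exact h x.2
  exact IsFinite.of_isProper_of_locallyQuasiFinite _

theorem mem_quasiFiniteLocus_of_forall_eq {X Y : Scheme.{u}} (f : X ⟶ Y) [LocallyOfFiniteType f]
    {x : X} (h : ∀ y, f y = f x → y = x) : x ∈ f.quasiFiniteLocus := by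
  rw [Scheme.Hom.mem_quasiFiniteLocus, Scheme.Hom.quasiFiniteAt_iff_isOpen_singleton_asFiber]
  have : {f.asFiber x} = (Set.univ : Set (f.fiber (f x))) := by
    refine Set.eq_univ_of_forall fun z ↦ (f.fiberι (f x)).isEmbedding.injective ?_
    rw [f.fiberι_asFiber]
    exact h _ ((f.range_fiberι (f x)).le ⟨z, rfl⟩)
  rw [this]
  exact isOpen_univ

end AlgebraicGeometry

theorem IsRegularLocalRingP.of_isField {R : Type*} [CommRing R] (h : IsField R) :
    IsRegularLocalRingP R := by
  let := h.toField
  have : IsNoetherianRing R := inferInstance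
  refine ⟨this, ∅, by simp, fun I hI ↦ ?_, ?_⟩
  · simpa using (Ideal.eq_bot_or_top I).resolve_right hI
  · exact (ringKrullDim_eq_zero_of_isField h).symm

theorem WithBot.add_ite_one_cancel {p : Prop} [Decidable p] {a b : WithBot ℕ∞}
    (h : a + (if p then 1 else 0) = b + (if p then 1 else 0)) : a = b := by
  split_ifs at h
  · cases a with
    | bot =>
      cases b with
      | bot => rfl
      | coe b => exact absurd h.symm WithBot.coe_ne_bot
    | coe a =>
      cases b with
      | bot => exact absurd h WithBot.coe_ne_bot
      | coe b => exact congr_arg _ (ENat.add_left_injective_of_ne_top ENat.one_ne_top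
          (WithBot.coe_injective h))
  · simpa using h

theorem exists_open_generically_finite_regular
    (S X Y : Scheme.{u}) [IrreducibleSpace S]
    (hJ2 : ∀ (T : Scheme.{u}) (g : T ⟶ S), LocallyOfFiniteType g →
      IsOpen {t : T | IsRegularLocalRingP (T.presheaf.stalk t)})
    (πX : X ⟶ S) (πY : Y ⟶ S) [LocallyOfFiniteType πX]
    [IsLocallyNoetherian Y] [LocallyOfFiniteType πY]
    (f : X ⟶ Y) (hf : f ≫ πY = πX)
    (W : Set X) (hWc : IsClosed W) (hWi : IsIrreducible W)
    (ηW : X) (hη : closure {ηW} = W)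
    (WS : Scheme.{u}) (ι : WS ⟶ X) [IsClosedImmersion ι] [IsReduced WS]
    (hιW : Set.range ι.base = W)
    (FW : Scheme.{u}) (κ : FW ⟶ Y) [IsClosedImmersion κ] [IsReduced FW]
    (hκW : Set.range κ.base = f.base '' W)
    (fW : WS ⟶ FW) (hfW : fW ≫ κ = ι ≫ f) [IsProper (ι ≫ f)]
    (hdim : SDimSucc πX ηW = SDimSucc πY (f.base ηW)) :
    ∃ U : Y.Opens,
      ((U : Set Y) ∩ (f.base '' W)).Nonempty ∧
      (∀ y : FW, κ.base y ∈ U → IsRegularLocalRingP (FW.presheaf.stalk y)) ∧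
      (∀ w : WS, ι.base w ∈ f ⁻¹ᵁ U → IsRegularLocalRingP (WS.presheaf.stalk w)) ∧
      IsFinite (fW ∣_ (κ ⁻¹ᵁ U)) := by
  subst hf
  have hηW : ηW ∈ W := hη ▸ subset_closure rfl
  have hfiber (w : X) (hw : w ∈ W) (hfw : f w = f ηW) : w = ηW := by
    by_contra hne
    have hlt := topologicalKrullDim_fiber_closure_singleton_lt f πY
      (specializes_iff_mem_closure.mpr (hη ▸ hw)) (Ne.symm hne) hfw.symm
    refine hlt.ne' ?_
    classical exact WithBot.add_ite_one_cancel hdim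
  have hcomm (w : WS) : κ (fW w) = f (ι w) := by
    rw [← Scheme.Hom.comp_apply, hfW, Scheme.Hom.comp_apply]
  obtain ⟨w₀, hw₀⟩ : ηW ∈ Set.range ι := hιW.ge hηW
  have hw₀_gen : closure {w₀} = Set.univ := by
    rw [ι.isEmbedding.isInducing.closure_singleton_eq_preimage, hw₀, hη]
    exact Set.eq_univ_of_forall fun w ↦ hιW.le ⟨w, rfl⟩
  have hw₀_fiber (w : WS) (hw : fW w = fW w₀) : w = w₀ := by
    refine ι.isEmbedding.injective ?_
    rw [hw₀]
    exact hfiber _ (hιW.le ⟨w, rfl⟩) (by rw [← hcomm, hw, hcomm, hw₀])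
  have hy₀_gen : closure {fW w₀} = Set.univ := by
    rw [κ.isEmbedding.isInducing.closure_singleton_eq_preimage, hcomm, hw₀]
    refine Set.eq_univ_of_forall fun y ↦ ?_
    obtain ⟨x, hx, hxy⟩ := hκW.le ⟨y, rfl⟩
    refine specializes_iff_mem_closure.mp (?_ : f ηW ⤳ κ y)
    exact hxy ▸ (specializes_iff_mem_closure.mpr (hη ▸ hx)).map f.continuous
  have : IsProper fW := by
    have : IsProper (fW ≫ κ) := hfW ▸ inferInstance
    exact .of_comp fW κ
  let RW : Set WS := {w | IsRegularLocalRingP (WS.presheaf.stalk w)}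
  let RF : Set FW := {y | IsRegularLocalRingP (FW.presheaf.stalk y)}
  have hRW : IsOpen RW := hJ2 WS (ι ≫ f ≫ πY) inferInstance
  have hRF : IsOpen RF := hJ2 FW (κ ≫ πY) inferInstance
  have hw₀R : w₀ ∈ RW := .of_isField (isField_stalk_of_closure_eq_univ hw₀_gen)
  have hy₀R : fW w₀ ∈ RF := .of_isField (isField_stalk_of_closure_eq_univ hy₀_gen)
  have hw₀Q : w₀ ∈ fW.quasiFiniteLocus := mem_quasiFiniteLocus_of_forall_eq fW hw₀_fiber
  let C : Set FW := fW '' (RW ∩ fW.quasiFiniteLocus)ᶜ ∪ RFᶜ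
  have hC : IsClosed C := (fW.isClosedMap _
    (hRW.inter fW.quasiFiniteLocus.isOpen).isClosed_compl).union hRF.isClosed_compl
  have hy₀C : fW w₀ ∉ C := by
    rintro (⟨w, hw, hww⟩ | h)
    · exact hw (hw₀_fiber w hww ▸ ⟨hw₀R, hw₀Q⟩)
    · exact h hy₀R
  let U : Y.Opens := ⟨(κ '' C)ᶜ, (κ.isClosedEmbedding.isClosedMap _ hC).isOpen_compl⟩
  have hU (y : FW) : κ y ∈ U ↔ y ∉ C := κ.isEmbedding.injective.mem_set_image.not
  have hUW (w : WS) (hw : ι w ∈ f ⁻¹ᵁ U) : w ∈ RW ∩ fW.quasiFiniteLocus := by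
    have h : fW w ∉ C := (hU _).mp (hcomm w ▸ hw)
    by_contra hw'
    exact h (.inl ⟨w, hw', rfl⟩)
  refine ⟨U, ⟨f ηW, ?_, ηW, hηW, rfl⟩, fun y hy ↦ ?_, fun w hw ↦ (hUW w hw).1,
    isFinite_morphismRestrict_of_preimage_le_quasiFiniteLocus fW _ fun w hw ↦ (hUW w ?_).2⟩
  · rw [← hw₀, ← hcomm]
    exact (hU _).mpr hy₀C
  · by_contra hy'
    exact (hU _).mp hy (.inr hy')
  · exact (hcomm w ▸ hw : f (ι w) ∈ U)
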